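/- arXiv:2211.06484 — 3 statements merged into one kernel-verified Lean document; each statement's English description precedes it below -/
import Mathlib

section
/- For every real s > 0, the sequence of partial sums V_s(n) := ∑_{k=3}^{n} (−1)^k k^{−s} exp(2πi(1/k − 2H_k)) converges to a limit in ℂ as n → ∞. -/
open Real Filter Topology

/-- The `k`-th harmonic number `H_k = ∑_{m=1}^{k} 1/m`. -/
noncomputable def H (k : ℕ) : ℝ := ∑ m ∈ Finset.Icc 1 k, (1 : ℝ) / m

/-- An alternating series whose terms tend to zero with summable variation converges. -/
theorem exists_tendsto_alternating_sum {a : ℕ → ℂ} (ha : Tendsto a atTop (𝓝 0))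
    (hv : Summable fun k => ‖a k - a (k + 1)‖) :
    ∃ L : ℂ, Tendsto (fun n => ∑ k ∈ Finset.range n, (-1 : ℂ) ^ k * a k) atTop (𝓝 L) := by
  have hS : Summable fun k => (-1 : ℂ) ^ k * (a k - a (k + 1)) :=
    Summable.of_norm (by simpa using hv)
  have hsum : ∀ n, ∑ k ∈ Finset.range n, (-1 : ℂ) ^ k * a k =
      (∑ k ∈ Finset.range n, (-1 : ℂ) ^ k * (a k - a (k + 1)) + a 0 - (-1) ^ n * a n) / 2 := by
    intro n
    induction n with
    | zero => simp
    | succ n ih =>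
      rw [Finset.sum_range_succ, Finset.sum_range_succ, ih]
      ring
  have hz : Tendsto (fun n => (-1 : ℂ) ^ n * a n) atTop (𝓝 0) :=
    tendsto_zero_iff_norm_tendsto_zero.2 (by simpa using ha.norm)
  refine ⟨_, Tendsto.congr (fun n => (hsum n).symm)
    (((hS.hasSum.tendsto_sum_nat.add_const (a 0)).sub hz).div_const 2)⟩

theorem norm_exp_ofReal_mul_I_sub_le (x y : ℝ) :
    ‖Complex.exp (x * Complex.I) - Complex.exp (y * Complex.I)‖ ≤ |x - y| := by
  have h : Complex.exp (x * Complex.I) - Complex.exp (y * Complex.I) =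
      Complex.exp (y * Complex.I) * (Complex.exp (Complex.I * ((x - y : ℝ) : ℂ)) - 1) := by
    rw [mul_sub, ← Complex.exp_add, mul_one]
    congr 2
    push_cast
    ring
  rw [h, norm_mul, Complex.norm_exp_ofReal_mul_I, one_mul]
  exact Real.norm_exp_I_mul_ofReal_sub_one_le

theorem summable_sub_succ_of_antitone {r : ℕ → ℝ} (hr : Antitone r) (h0 : ∀ k, 0 ≤ r k) :
    Summable fun k => r k - r (k + 1) := by
  refine summable_of_sum_range_le (c := r 0) (fun k => sub_nonneg.2 (hr k.le_succ)) fun n => ?_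
  rw [Finset.sum_range_sub']
  linarith [h0 n]

/-- An alternating series with positive decreasing moduli `r k → 0` and phases `θ k` converges as
soon as the phase increments weighted by the moduli are summable. -/
theorem exists_tendsto_alternating_sum_polar {r θ : ℕ → ℝ} (hr : Antitone r)
    (h0 : ∀ k, 0 ≤ r k) (hlim : Tendsto r atTop (𝓝 0))
    (hθ : Summable fun k => r k * |θ k - θ (k + 1)|) :
    ∃ L : ℂ, Tendsto (fun n => ∑ k ∈ Finset.range n,
      (-1 : ℂ) ^ k * (r k * Complex.exp (θ k * Complex.I))) atTop (𝓝 L) := by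
  refine exists_tendsto_alternating_sum ?_ ?_
  · refine tendsto_zero_iff_norm_tendsto_zero.2 (hlim.congr fun k => ?_)
    rw [norm_mul, Complex.norm_exp_ofReal_mul_I, mul_one, Complex.norm_of_nonneg (h0 k)]
  · refine Summable.of_nonneg_of_le (fun k => norm_nonneg _) (fun k => ?_)
      (hθ.add (summable_sub_succ_of_antitone hr h0))
    have h : (r k : ℂ) * Complex.exp (θ k * Complex.I) -
        r (k + 1) * Complex.exp (θ (k + 1) * Complex.I) =
        r k * (Complex.exp (θ k * Complex.I) - Complex.exp (θ (k + 1) * Complex.I)) +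
        ((r k - r (k + 1) : ℝ) : ℂ) * Complex.exp (θ (k + 1) * Complex.I) := by
      push_cast
      ring
    rw [h]
    refine (norm_add_le _ _).trans ?_
    rw [norm_mul, norm_mul, Complex.norm_exp_ofReal_mul_I, mul_one, Complex.norm_of_nonneg (h0 k),
      Complex.norm_of_nonneg (sub_nonneg.2 (hr k.le_succ))]
    gcongr
    · exact h0 k
    · exact norm_exp_ofReal_mul_I_sub_le _ _

theorem H_succ (k : ℕ) : H (k + 1) = H k + 1 / ((k : ℝ) + 1) := by
  rw [H, Finset.sum_Icc_succ_top (by omega), H]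
  push_cast
  rfl

theorem vertex_points_converge (s : ℝ) (hs : 0 < s) :
    ∃ L : ℂ, Tendsto
      (fun n : ℕ => ∑ k ∈ Finset.Icc 3 n,
        (-1 : ℂ) ^ k * (((k : ℝ) ^ (-s) : ℝ) : ℂ) *
          Complex.exp (2 * (π : ℂ) * Complex.I * (1 / (k : ℂ) - 2 * (H k : ℂ))))
      atTop (𝓝 L) := by
  let r : ℕ → ℝ := fun k => ((k + 3 : ℕ) : ℝ) ^ (-s)
  let θ : ℕ → ℝ := fun k => 2 * π * (1 / ((k + 3 : ℕ) : ℝ) - 2 * H (k + 3))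
  have hanti : Antitone r := fun j k hjk =>
    Real.rpow_le_rpow_of_nonpos (by positivity) (by exact_mod_cast Nat.add_le_add_right hjk 3)
      (by linarith)
  have hlim : Tendsto r atTop (𝓝 0) :=
    ((tendsto_rpow_neg_atTop hs).comp tendsto_natCast_atTop_atTop).comp (tendsto_add_atTop_nat 3)
  have hθ : Summable fun k => r k * |θ k - θ (k + 1)| := by
    have hp : Summable fun k : ℕ => 4 * π * ((k + 3 : ℕ) : ℝ) ^ (-s - 1) :=
      ((summable_nat_add_iff 3).2 (Real.summable_nat_rpow.2 (by linarith))).mul_left _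
    refine Summable.of_nonneg_of_le (fun k => by positivity) (fun k => ?_) hp
    have hk : (0 : ℝ) < ((k + 3 : ℕ) : ℝ) := by positivity
    have hdiff : θ k - θ (k + 1) =
        2 * π * (1 / ((k + 3 : ℕ) : ℝ) + 1 / (((k + 3 : ℕ) : ℝ) + 1)) := by
      simp only [θ]
      rw [show k + 1 + 3 = k + 3 + 1 by ring, H_succ (k + 3)]
      push_cast
      ring
    have hle : 1 / (((k + 3 : ℕ) : ℝ) + 1) ≤ 1 / ((k + 3 : ℕ) : ℝ) :=
      one_div_le_one_div_of_le hk (by linarith)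
    rw [hdiff, abs_of_nonneg (by positivity), Real.rpow_sub_one hk.ne']
    calc r k * (2 * π * (1 / ((k + 3 : ℕ) : ℝ) + 1 / (((k + 3 : ℕ) : ℝ) + 1)))
        ≤ r k * (2 * π * (1 / ((k + 3 : ℕ) : ℝ) + 1 / ((k + 3 : ℕ) : ℝ))) := by gcongr
      _ = 4 * π * (((k + 3 : ℕ) : ℝ) ^ (-s) / ((k + 3 : ℕ) : ℝ)) := by
        simp only [r]
        ring
  obtain ⟨L, hL⟩ := exists_tendsto_alternating_sum_polar hanti (fun k => by positivity) hlim hθ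
  refine ⟨-L, (tendsto_add_atTop_iff_nat 2).1 (hL.neg.congr fun n => ?_)⟩
  rw [← Finset.Ico_add_one_right_eq_Icc, Finset.sum_Ico_eq_sum_range, ← Finset.sum_neg_distrib]
  refine Finset.sum_congr (by congr 1) fun k _ => ?_
  rw [add_comm 3 k, pow_add]
  have he : 2 * (π : ℂ) * Complex.I * (1 / ((k + 3 : ℕ) : ℂ) - 2 * (H (k + 3) : ℂ)) =
      (θ k : ℂ) * Complex.I := by
    simp only [θ]
    push_cast
    ring
  rw [he]
  simp only [r]
  ring
end

section
/- The real function B(t) := 2(2t−1)·sin(π(1/(2t−1) + 1/(2t))) is strictly monotone increasing on the interval [2, ∞). -/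
open Real

/-- If `0 ≤ y < x < π`, then `y * cos x < sin x`. -/
theorem mul_cos_lt_sin {x y : ℝ} (hy : 0 ≤ y) (hyx : y < x) (hx : x < π) :
    y * cos x < sin x := by
  rcases lt_or_ge x (π / 2) with h | h
  · have hcos : 0 < cos x := cos_pos_of_mem_Ioo ⟨by linarith [pi_pos], h⟩
    have htan := lt_tan (hy.trans_lt hyx) h
    rw [tan_eq_sin_div_cos, lt_div_iff₀ hcos] at htan
    exact (mul_lt_mul_of_pos_right hyx hcos).trans htan
  · have hcos : cos x ≤ 0 := cos_nonpos_of_pi_div_two_le_of_le h (by linarith [pi_pos])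
    exact (mul_nonpos_of_nonneg_of_nonpos hy hcos).trans_lt
      (sin_pos_of_pos_of_lt_pi (hy.trans_lt hyx) hx)

theorem hasDerivAt_mul_sin_pi_mul {t : ℝ} (h₁ : 2 * t - 1 ≠ 0) (h₂ : 2 * t ≠ 0) :
    HasDerivAt
      (fun t : ℝ => 2 * (2 * t - 1) * sin (π * (1 / (2 * t - 1) + 1 / (2 * t))))
      (4 * (sin (π * (1 / (2 * t - 1) + 1 / (2 * t))) -
        π * (1 / (2 * t - 1) + (2 * t - 1) / (2 * t) ^ 2) *
          cos (π * (1 / (2 * t - 1) + 1 / (2 * t))))) t := by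
  have hb : HasDerivAt (fun t : ℝ => 2 * t) 2 t := by
    simpa using (hasDerivAt_id t).const_mul 2
  have ha : HasDerivAt (fun t : ℝ => 2 * t - 1) 2 t := hb.sub_const 1
  have hx : HasDerivAt (fun t : ℝ => π * (1 / (2 * t - 1) + 1 / (2 * t)))
      (π * (-2 / (2 * t - 1) ^ 2 + -2 / (2 * t) ^ 2)) t := by
    simp only [one_div]
    exact ((ha.fun_inv h₁).add (hb.fun_inv h₂)).const_mul π
  refine ((ha.const_mul 2).mul hx.sin).congr_deriv ?_
  generalize cos (π * (1 / (2 * t - 1) + 1 / (2 * t))) = c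
  generalize sin (π * (1 / (2 * t - 1) + 1 / (2 * t))) = s
  field_simp
  ring

theorem B_strictMonoOn :
    StrictMonoOn
      (fun t : ℝ => 2 * (2 * t - 1) * Real.sin (π * (1 / (2 * t - 1) + 1 / (2 * t))))
      (Set.Ici (2 : ℝ)) := by
  have hderiv (t : ℝ) (ht : 2 ≤ t) :=
    hasDerivAt_mul_sin_pi_mul (t := t) (by linarith) (by linarith)
  refine strictMonoOn_of_deriv_pos (convex_Ici 2)
    (fun t ht => (hderiv t ht).continuousAt.continuousWithinAt) fun t ht => ?_
  have ht : 2 ≤ t := interior_subset ht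
  rw [(hderiv t ht).deriv]
  have ha : 0 < 2 * t - 1 := by linarith
  have hb : 0 < 2 * t := by linarith
  refine mul_pos four_pos (sub_pos.mpr (mul_cos_lt_sin (by positivity) ?_ ?_))
  · have h : (2 * t - 1) / (2 * t) ^ 2 < 1 / (2 * t) := by
      rw [div_lt_div_iff₀ (by positivity) hb]
      nlinarith
    gcongr
  · have h₁ : 1 / (2 * t - 1) ≤ 1 / 3 := one_div_le_one_div_of_le (by norm_num) (by linarith)
    have h₂ : 1 / (2 * t) ≤ 1 / 4 := one_div_le_one_div_of_le (by norm_num) (by linarith)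
    exact mul_lt_of_lt_one_right pi_pos (by linarith)
end

section
/- Let γ denote the Euler–Mascheroni constant, let ψ denote the digamma function (the logarithmic derivative of the Gamma function), and for real n > 1 define C(n) := −1 + exp(iπn)·exp(−4πi(γ + ψ(n+1)))·(1 + exp(2πi/n) + (exp(2πi/n)+1)/(exp(2πi/n)−1)). Let φ := (1+√5)/2 be the golden ratio. Then C(φ) = C(φ+1). -/
open Real Filter Topology

/-- The digamma function: the logarithmic derivative of the Gamma function. -/
noncomputable def digamma (x : ℝ) : ℝ := deriv (fun y : ℝ => Real.log (Real.Gamma y)) x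

/-- The analytic continuation `C(n) = V_L(n) + Q_L(n)` of the centers of the
telescoping spiral. -/
noncomputable def C (n : ℝ) : ℂ :=
  -1 + Complex.exp (Complex.I * (π : ℂ) * (n : ℂ)) *
    Complex.exp (-4 * (π : ℂ) * Complex.I *
      ((Real.eulerMascheroniConstant + digamma (n + 1) : ℝ) : ℂ)) *
    (1 + Complex.exp (2 * (π : ℂ) * Complex.I / (n : ℂ)) +
      (Complex.exp (2 * (π : ℂ) * Complex.I / (n : ℂ)) + 1) /
        (Complex.exp (2 * (π : ℂ) * Complex.I / (n : ℂ)) - 1))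

theorem digamma_add_one {x : ℝ} (hx : 0 < x) : digamma (x + 1) = digamma x + 1 / x := by
  have hG : DifferentiableAt ℝ (fun y : ℝ => Real.log (Real.Gamma y)) x := by
    refine (Real.differentiableAt_Gamma fun m => ?_).log (Real.Gamma_pos_of_pos hx).ne'
    have : (0 : ℝ) ≤ m := m.cast_nonneg
    linarith
  have hev : (fun y : ℝ => Real.log (Real.Gamma (y + 1))) =ᶠ[𝓝 x]
      fun y => Real.log (Real.Gamma y) + Real.log y := by
    filter_upwards [lt_mem_nhds hx] with y hy
    rw [Real.Gamma_add_one hy.ne', Real.log_mul hy.ne' (Real.Gamma_pos_of_pos hy).ne', add_comm]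
  unfold digamma
  rw [← deriv_comp_add_const (fun y : ℝ => Real.log (Real.Gamma y)) 1 x, hev.deriv_eq,
    deriv_fun_add hG (Real.differentiableAt_log hx.ne'), Real.deriv_log, one_div]

/-- For `x > 1` the root of unity `exp (2πi / x)` is not `1`. -/
theorem exp_two_pi_mul_I_div_ne_one {x : ℝ} (hx : 1 < x) :
    Complex.exp (2 * (π : ℂ) * Complex.I / (x : ℂ)) ≠ 1 := by
  intro h
  obtain ⟨n, hn⟩ := Complex.exp_eq_one_iff.1 h
  have hx0 : (x : ℂ) ≠ 0 := by exact_mod_cast (zero_lt_one.trans hx).ne'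
  have hnx : (1 : ℂ) = n * x := by
    refine mul_right_cancel₀ Complex.two_pi_I_ne_zero ?_
    rw [div_eq_iff hx0] at hn
    linear_combination hn
  have hnx : (1 : ℝ) = n * x := by exact_mod_cast hnx
  have hpos : (0 : ℝ) < n := by
    by_contra! hle
    nlinarith
  have hone : (1 : ℝ) ≤ n := by
    have : (0 : ℤ) < n := by exact_mod_cast hpos
    exact_mod_cast this
  nlinarith

/-- The centers at `x` and `x + 1` coincide when `1 / x + 1 / (x + 1) = 1`. -/
theorem C_eq_C_add_one {x : ℝ} (hx : 1 < x) (h : 1 / x + 1 / (x + 1) = 1) :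
    C x = C (x + 1) := by
  have hx1 : 0 < x + 1 := by linarith
  have hw := exp_two_pi_mul_I_div_ne_one hx
  have hu : Complex.exp (2 * (π : ℂ) * Complex.I / ((x + 1 : ℝ) : ℂ)) =
      (Complex.exp (2 * (π : ℂ) * Complex.I / (x : ℂ)))⁻¹ := by
    have hc : 1 / (x : ℂ) + 1 / ((x + 1 : ℝ) : ℂ) = 1 := by exact_mod_cast h
    have he : 2 * (π : ℂ) * Complex.I / ((x + 1 : ℝ) : ℂ) =
        2 * (π : ℂ) * Complex.I - 2 * (π : ℂ) * Complex.I / (x : ℂ) := by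
      linear_combination 2 * (π : ℂ) * Complex.I * hc
    rw [he, Complex.exp_sub, Complex.exp_two_pi_mul_I, one_div]
  have hrot : Complex.exp (Complex.I * (π : ℂ) * ((x + 1 : ℝ) : ℂ)) =
      -Complex.exp (Complex.I * (π : ℂ) * (x : ℂ)) := by
    have he : Complex.I * (π : ℂ) * ((x + 1 : ℝ) : ℂ) =
        Complex.I * (π : ℂ) * (x : ℂ) + π * Complex.I := by
      push_cast
      ring
    rw [he, Complex.exp_add, Complex.exp_pi_mul_I, mul_neg_one]
  have hpsi : Complex.exp (-4 * (π : ℂ) * Complex.I *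
        ((Real.eulerMascheroniConstant + digamma (x + 1 + 1) : ℝ) : ℂ)) =
      Complex.exp (-4 * (π : ℂ) * Complex.I *
        ((Real.eulerMascheroniConstant + digamma (x + 1) : ℝ) : ℂ)) *
      Complex.exp (2 * (π : ℂ) * Complex.I / (x : ℂ)) ^ 2 := by
    rw [digamma_add_one hx1, ← inv_inv (Complex.exp (2 * (π : ℂ) * Complex.I / (x : ℂ))), ← hu,
      ← Complex.exp_neg, ← Complex.exp_nat_mul, ← Complex.exp_add]
    congr 1
    push_cast
    ring
  unfold C
  rw [hpsi, hrot, hu]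
  have hw0 := Complex.exp_ne_zero (2 * (π : ℂ) * Complex.I / (x : ℂ))
  generalize Complex.exp (2 * (π : ℂ) * Complex.I / (x : ℂ)) = w at *
  have hw1 : w - 1 ≠ 0 := sub_ne_zero.2 hw
  have hw2 : 1 - w ≠ 0 := sub_ne_zero.2 hw.symm
  have key : 1 + w + (w + 1) / (w - 1) = -w ^ 2 * (1 + w⁻¹ + (w⁻¹ + 1) / (w⁻¹ - 1)) := by
    have hfrac : (w⁻¹ + 1) / (w⁻¹ - 1) = -((w + 1) / (w - 1)) := by
      have hinv : w⁻¹ - 1 = (1 - w) / w := by field_simp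
      rw [hinv]
      field_simp
      ring
    rw [hfrac]
    field_simp
    ring
  rw [key]
  ring

theorem golden_ratio_intersection :
    C ((1 + Real.sqrt 5) / 2) = C ((1 + Real.sqrt 5) / 2 + 1) := by
  refine C_eq_C_add_one Real.one_lt_goldenRatio ?_
  have hsq : ((1 + √5) / 2) ^ 2 = (1 + √5) / 2 + 1 := Real.goldenRatio_sq
  have hpos : 0 < (1 + √5) / 2 := Real.goldenRatio_pos
  generalize (1 + √5) / 2 = r at *
  field_simp
  linear_combination -hsq
end
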